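/- arXiv:2604.14614 — 2 statements merged into one kernel-verified Lean document; each statement's English description precedes it below -/
import Mathlib

section
/- Let n, k ≥ 1, let w_1, …, w_k ∈ ℝⁿ be unit vectors, let θ_1, …, θ_k ∈ ℝ, and let f : ℝⁿ → {−1, +1} be defined by f(x) = +1 if w_i · x > θ_i for all i ∈ [k], and f(x) = −1 otherwise. Let S ⊆ ℝⁿ be a set, let R > 0 satisfy ‖x‖ ≤ R for all x ∈ S, and let ρ ∈ (0, 1]. Suppose S is ρ-robust with respect to f, i.e., for every x ∈ S and every y ∈ ℝⁿ with f(y) ≠ f(x) we have ‖x − y‖ ≥ ρ·R, and suppose there exists y ∈ S with f(y) = +1. Then for every x ∈ S with f(x) = −1 there exists i ∈ [k] such that (w_i · x − θ_i)/R ≤ −ρ²/2. -/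
open scoped RealInnerProductSpace

/-- A point of an intersection of open halfspaces with unit normals whose distance to the complement
is at least `r` satisfies every constraint with slack `r`. -/
theorem slack_of_robust {E ι : Type*} [NormedAddCommGroup E] [InnerProductSpace ℝ E]
    {w : ι → E} (hw : ∀ i, ‖w i‖ = 1) {θ : ι → ℝ} {r : ℝ} {y : E} (hy : ∀ i, θ i < ⟪w i, y⟫)
    (hrobust : ∀ z, (¬ ∀ i, θ i < ⟪w i, z⟫) → r ≤ ‖y - z‖) (i : ι) : r ≤ ⟪w i, y⟫ - θ i := by
  have h := hrobust (y - (⟪w i, y⟫ - θ i) • w i) fun h => by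
    have := h i
    rw [inner_sub_right, inner_smul_right, real_inner_self_eq_norm_sq, hw i] at this
    linarith
  rwa [sub_sub_cancel, norm_smul, hw i, mul_one, Real.norm_of_nonneg (sub_pos.2 (hy i)).le] at h

/-- If a set `S` (bounded by `R`) is `ρ`-robust with respect to an intersection of
halfspaces `f` and `S` contains a positive point, then `f` has a `ρ²/2` margin on `S`. -/
theorem robust_implies_margin
    (n k : ℕ) (hn : 1 ≤ n) (hk : 1 ≤ k)
    (w : Fin k → EuclideanSpace ℝ (Fin n)) (hw : ∀ i, ‖w i‖ = 1)
    (θ : Fin k → ℝ) (f : EuclideanSpace ℝ (Fin n) → ℝ)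
    (hf : ∀ x, ((∀ i, θ i < ⟪w i, x⟫) → f x = 1) ∧
      ((¬ ∀ i, θ i < ⟪w i, x⟫) → f x = -1))
    (S : Set (EuclideanSpace ℝ (Fin n))) (R : ℝ) (hR : 0 < R)
    (hSR : ∀ x ∈ S, ‖x‖ ≤ R) (ρ : ℝ) (hρ : ρ ∈ Set.Ioc (0 : ℝ) 1)
    (hrobust : ∀ x ∈ S, ∀ y : EuclideanSpace ℝ (Fin n), f y ≠ f x → ρ * R ≤ ‖x - y‖)
    (hpos : ∃ y ∈ S, f y = 1) :
    ∀ x ∈ S, f x = -1 → ∃ i, (⟪w i, x⟫ - θ i) / R ≤ -ρ ^ 2 / 2 := by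
  obtain ⟨hρ0, -⟩ := hρ
  obtain ⟨y, hyS, hy⟩ := hpos
  have hneg : ∀ z, (¬ ∀ i, θ i < ⟪w i, z⟫) → f z = -1 := fun z => (hf z).2
  have hypos : ∀ i, θ i < ⟪w i, y⟫ := by
    by_contra h
    have := hneg y h
    linarith
  have hslack : ∀ i, ρ * R ≤ ⟪w i, y⟫ - θ i :=
    slack_of_robust hw hypos fun z hz => hrobust y hyS z (by rw [hneg z hz, hy]; norm_num)
  intro x hxS hx
  by_contra! hcon
  set t : ℝ := ρ / (2 + ρ) with ht
  have ht0 : 0 < t := by positivity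
  have ht_mul : t * (2 + ρ) = ρ := div_mul_cancel₀ _ (by positivity)
  have ht1 : t < 1 := (div_lt_one (by positivity)).2 (by linarith)
  have hz : f (x + t • (y - x)) = 1 := (hf _).1 fun i => by
    have h1 := (lt_div_iff₀ hR).1 (hcon i)
    have h2 := mul_lt_mul_of_pos_left h1 (sub_pos.2 ht1)
    have h3 := mul_le_mul_of_nonneg_left (hslack i) ht0.le
    have h4 : (1 - t) * (-ρ ^ 2 / 2 * R) + t * (ρ * R) = 0 := by
      linear_combination (ρ * R / 2) * ht_mul
    rw [inner_add_right, inner_smul_right, inner_sub_right]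
    linarith
  have hdist := hrobust x hxS _ (by rw [hz, hx]; norm_num : f (x + t • (y - x)) ≠ f x)
  rw [sub_add_cancel_left, norm_neg, norm_smul, Real.norm_of_nonneg ht0.le] at hdist
  have hyx : ‖y - x‖ ≤ 2 * R := by linarith [norm_sub_le y x, hSR x hxS, hSR y hyS]
  have hle := hdist.trans (mul_le_mul_of_nonneg_left hyx ht0.le)
  have hgap : ρ * R - t * (2 * R) = t * ρ * R := by linear_combination -R * ht_mul
  have : 0 < t * ρ * R := by positivity
  linarith
end

section
/- Let μ be a probability measure on a measurable space Ω, let F ⊆ Ω be measurable, let ε ∈ (0, 1/2], let t ≥ 0, and let Ω = A_0 ⊇ A_1 ⊇ ⋯ ⊇ A_t be a decreasing chain of measurable sets such that for every k with 0 ≤ k < t, μ(Fᶜ ∩ (A_k \ A_{k+1})) ≥ (1/(2ε)) · μ(F ∩ (A_k \ A_{k+1})). Then μ(F ∩ A_t) ≥ μ(F) − 2ε. In particular, if μ(F) ≥ 4ε, then μ(F ∩ A_t) ≥ 2ε. -/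
open MeasureTheory

/-- Removing a smaller set `B ⊆ A` from `S` instead of `A` adds the mass of `S ∩ (A \ B)`. -/
theorem measure_diff_eq_add_measure_inter_diff {Ω : Type*} [MeasurableSpace Ω] (μ : Measure Ω)
    (S : Set Ω) {A B : Set Ω} (hA : MeasurableSet A) (hBA : B ⊆ A) :
    μ (S \ B) = μ (S \ A) + μ (S ∩ (A \ B)) := by
  rw [← measure_inter_add_sdiff (S \ B) hA, add_comm]
  congr 2 <;> ext x <;> have := @hBA x <;> simp <;> tauto

/-- A stagewise comparison of the masses rejected from `S` and `T` along a decreasing chain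
sums to a comparison of the total rejected masses. -/
theorem mul_measure_diff_le_of_chain {Ω : Type*} [MeasurableSpace Ω] (μ : Measure Ω)
    (S T : Set Ω) (c : ENNReal) (t : ℕ) (A : ℕ → Set Ω) (hA0 : A 0 = Set.univ)
    (hAmeas : ∀ k ≤ t, MeasurableSet (A k)) (hAchain : ∀ k < t, A (k + 1) ⊆ A k)
    (hstage : ∀ k < t, c * μ (S ∩ (A k \ A (k + 1))) ≤ μ (T ∩ (A k \ A (k + 1)))) :
    c * μ (S \ A t) ≤ μ (T \ A t) := by
  induction t with
  | zero => simp [hA0]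
  | succ t ih =>
    have hmeas := hAmeas t t.le_succ
    have hsub := hAchain t t.lt_succ_self
    rw [measure_diff_eq_add_measure_inter_diff μ S hmeas hsub,
      measure_diff_eq_add_measure_inter_diff μ T hmeas hsub, mul_add]
    exact add_le_add
      (ih (fun k hk => hAmeas k (by omega)) (fun k hk => hAchain k (by omega))
        (fun k hk => hstage k (by omega)))
      (hstage t t.lt_succ_self)

/-- The positive mass is never exhausted by boosting-by-covering: if at each stage
the newly rejected set carries at least `1/(2ε)` times more `Fᶜ`-mass than `F`-mass,
then the `F`-mass of the final accepted set is at least `μ(F) − 2ε`; in particular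
it is at least `2ε` whenever `μ(F) ≥ 4ε`. -/
theorem positive_mass_not_exhausted
    {Ω : Type*} [MeasurableSpace Ω] (μ : Measure Ω) [IsProbabilityMeasure μ]
    (F : Set Ω) (hF : MeasurableSet F)
    (ε : ℝ) (hε : ε ∈ Set.Ioc (0 : ℝ) (1 / 2))
    (t : ℕ) (A : ℕ → Set Ω) (hA0 : A 0 = Set.univ)
    (hAmeas : ∀ k ≤ t, MeasurableSet (A k))
    (hAchain : ∀ k < t, A (k + 1) ⊆ A k)
    (hstage : ∀ k < t,
      ENNReal.ofReal (1 / (2 * ε)) * μ (F ∩ (A k \ A (k + 1))) ≤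
        μ (Fᶜ ∩ (A k \ A (k + 1)))) :
    μ F - ENNReal.ofReal (2 * ε) ≤ μ (F ∩ A t) ∧
      (ENNReal.ofReal (4 * ε) ≤ μ F → ENNReal.ofReal (2 * ε) ≤ μ (F ∩ A t)) := by
  have h2ε : 0 < 2 * ε := by linarith [hε.1]
  have hrej : μ (F \ A t) ≤ ENNReal.ofReal (2 * ε) := by
    have h := (mul_measure_diff_le_of_chain μ F Fᶜ _ t A hA0 hAmeas hAchain hstage).trans
      prob_le_one
    rw [one_div, ENNReal.ofReal_inv_of_pos h2ε, mul_comm, ← div_eq_mul_inv] at h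
    simpa using (ENNReal.div_le_iff (by simpa using hε.1) ENNReal.ofReal_ne_top).1 h
  have hmain : μ F - ENNReal.ofReal (2 * ε) ≤ μ (F ∩ A t) := by
    rw [tsub_le_iff_right, ← measure_inter_add_sdiff F (hAmeas t le_rfl)]
    gcongr
  refine ⟨hmain, fun h => le_trans ?_ hmain⟩
  refine ENNReal.le_sub_of_add_le_right ENNReal.ofReal_ne_top (le_trans (le_of_eq ?_) h)
  rw [← ENNReal.ofReal_add h2ε.le h2ε.le]
  ring_nf
end
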